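/- Genie-aided replication (Lemma 3): For any nonnegative payment mechanism R : X^N → ℝ^N and any Nash equilibrium σ of R, there exists a nonnegative genie-aided payment mechanism R̂ = (R̂_1,…,R̂_N), R̂_i : X × {0,1} → [0,∞), such that σ is also a Nash equilibrium of R̂ and, for every individual i, E_σ[R̂_i(X_i, W)] = E_σ[R_i(X)]. -/

import Mathlib

open Real

/-- The set of possible reports: `some b` is report `b ∈ {0,1}`, `none` is nonparticipation `⊥`. -/
abbrev Report := Option Bool

/-- A (behavioral) strategy: a conditional distribution of the report given the signal. -/
def IsStrategy (σ : Bool → Report → ℝ) : Prop :=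
  (∀ s x, 0 ≤ σ s x) ∧ ∀ s, ∑ x : Report, σ s x = 1

/-- `P_σ(X ∈ E | S = s)`. -/
def probE (σ : Bool → Report → ℝ) (E : Finset Report) (s : Bool) : ℝ :=
  ∑ x ∈ E, σ s x

/-- One log-likelihood-ratio term `ln(a/b)`, with the convention `0/0 = 1`,
clamped into `[0,∞]` (this does not change the supremum defining the privacy level,
since the supremum is always ≥ 0). -/
noncomputable def llr (a b : ℝ) : ENNReal :=
  if a = 0 ∧ b = 0 then 0
  else if b = 0 then ⊤
  else ENNReal.ofReal (Real.log (a / b))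

/-- The (local) differential privacy level `ζ(σ)` of a strategy, valued in `[0,∞]`. -/
noncomputable def privLevel (σ : Bool → Report → ℝ) : ENNReal :=
  ⨆ (E : Finset Report), ⨆ (s : Bool), llr (probE σ E s) (probE σ E (!s))

/-- The privacy cost `g(ζ(σ))`, valued in extended reals (at `ζ = ∞` we take the
supremum extension of `g`). -/
noncomputable def privCost (g : ℝ → ℝ) (σ : Bool → Report → ℝ) : EReal :=
  if privLevel σ = ⊤ then ⨆ x ∈ Set.Ici (0:ℝ), ((g x : ℝ) : EReal)
  else ((g (privLevel σ).toReal : ℝ) : EReal)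

/-- `P(S_i = s | W = w) = θ` if `s = w`, else `1 - θ`. -/
def signalProb (θ : ℝ) (w s : Bool) : ℝ := if s = w then θ else 1 - θ

/-- Joint probability of state `w`, signals `s` and reports `x`, where `p = P_W(1)`. -/
def jointProb {N : ℕ} (p θ : ℝ) (σ : Fin N → Bool → Report → ℝ)
    (w : Bool) (s : Fin N → Bool) (x : Fin N → Report) : ℝ :=
  (if w then p else 1 - p) * ∏ i, (signalProb θ w (s i) * σ i (s i) (x i))

/-- Expected payment `E_σ[R_i(X)]` to individual `i`. -/
noncomputable def expPay {N : ℕ} (p θ : ℝ) (σ : Fin N → Bool → Report → ℝ)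
    (R : (Fin N → Report) → Fin N → ℝ) (i : Fin N) : ℝ :=
  ∑ w : Bool, ∑ s : Fin N → Bool, ∑ x : Fin N → Report,
    jointProb p θ σ w s x * R x i

/-- Expected utility of individual `i`: expected payment minus privacy cost. -/
noncomputable def utility {N : ℕ} (p θ : ℝ) (g : ℝ → ℝ)
    (σ : Fin N → Bool → Report → ℝ)
    (R : (Fin N → Report) → Fin N → ℝ) (i : Fin N) : EReal :=
  ((expPay p θ σ R i : ℝ) : EReal) - privCost g (σ i)

/-- `σ` is a Nash equilibrium of the payment mechanism `R`. -/
def NashEq {N : ℕ} (p θ : ℝ) (g : ℝ → ℝ)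
    (σ : Fin N → Bool → Report → ℝ)
    (R : (Fin N → Report) → Fin N → ℝ) : Prop :=
  (∀ i, IsStrategy (σ i)) ∧
  ∀ (i : Fin N) (σ' : Bool → Report → ℝ), IsStrategy σ' →
    utility p θ g (Function.update σ i σ') R i ≤ utility p θ g σ R i

/-- The `ε`-strategy: symmetric randomized response flipping with prob. `1/(e^ε+1)`. -/
noncomputable def epsStrategy (ε : ℝ) : Bool → Report → ℝ :=
  fun s x => match x with
  | none => 0
  | some b => if b = s then Real.exp ε / (Real.exp ε + 1) else 1 / (Real.exp ε + 1)

/-- The lower bound `V_LB(ε)` on the value of `ε` units of privacy. -/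
noncomputable def VLB (θ : ℝ) (g' : ℝ → ℝ) (ε : ℝ) : ℝ :=
  g' ε * ((Real.exp ε + 1) / Real.exp ε) *
    ((θ / (2 * θ - 1)) * (Real.exp ε + 1) - 1)

/-- The hypotheses on the privacy cost function `g` (with derivative `g'`):
proper (nonnegative, `g(0) = 0`, non-decreasing), convex, continuously differentiable,
and vanishing only at `0`. -/
structure ProperCost (g g' : ℝ → ℝ) : Prop where
  conv : ConvexOn ℝ (Set.Ici 0) g
  deriv : ∀ x ∈ Set.Ici (0:ℝ), HasDerivAt g (g' x) x
  derivCont : ContinuousOn g' (Set.Ici 0)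
  mono : MonotoneOn g (Set.Ici 0)
  nonneg : ∀ x ∈ Set.Ici (0:ℝ), 0 ≤ g x
  zero : g 0 = 0
  pos : ∀ x > (0:ℝ), 0 < g x


/-- Expected payment `E_σ[R̂_i(X_i, W)]` to individual `i` under a genie-aided mechanism
`R̂`, which pays individual `i` based on her own report and the underlying state. -/
noncomputable def expPayGenie {N : ℕ} (p θ : ℝ) (σ : Fin N → Bool → Report → ℝ)
    (Rh : Fin N → Report → Bool → ℝ) (i : Fin N) : ℝ :=
  ∑ w : Bool, ∑ s : Fin N → Bool, ∑ x : Fin N → Report,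
    jointProb p θ σ w s x * Rh i (x i) w

/-- Expected utility of individual `i` under a genie-aided mechanism. -/
noncomputable def utilityGenie {N : ℕ} (p θ : ℝ) (g : ℝ → ℝ)
    (σ : Fin N → Bool → Report → ℝ)
    (Rh : Fin N → Report → Bool → ℝ) (i : Fin N) : EReal :=
  ((expPayGenie p θ σ Rh i : ℝ) : EReal) - privCost g (σ i)

/-- `σ` is a Nash equilibrium of the genie-aided mechanism `R̂`. -/
def NashEqGenie {N : ℕ} (p θ : ℝ) (g : ℝ → ℝ)
    (σ : Fin N → Bool → Report → ℝ)
    (Rh : Fin N → Report → Bool → ℝ) : Prop :=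
  (∀ i, IsStrategy (σ i)) ∧
  ∀ (i : Fin N) (σ' : Bool → Report → ℝ), IsStrategy σ' →
    utilityGenie p θ g (Function.update σ i σ') Rh i ≤ utilityGenie p θ g σ Rh i

/-- The probability of report `y` given state `w` under the strategy `τ`. -/
def reportProb (θ : ℝ) (τ : Bool → Report → ℝ) (w : Bool) (y : Report) : ℝ :=
  ∑ s : Bool, signalProb θ w s * τ s y

/-- The expected payment to individual `i` given her report `y` and the state `w`. -/
def condPay {N : ℕ} (θ : ℝ) (σ : Fin N → Bool → Report → ℝ)
    (R : (Fin N → Report) → Fin N → ℝ) (i : Fin N) (y : Report) (w : Bool) : ℝ :=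
  ∑ x : Fin N → Report,
    if x i = y then (∏ j ∈ Finset.univ.erase i, reportProb θ (σ j) w (x j)) * R x i else 0

lemma signalProb_nonneg {θ : ℝ} (h0 : 0 ≤ θ) (h1 : θ ≤ 1) (w s : Bool) :
    0 ≤ signalProb θ w s := by
  unfold signalProb
  split_ifs <;> linarith

lemma sum_signalProb (θ : ℝ) (w : Bool) : ∑ s : Bool, signalProb θ w s = 1 := by
  cases w <;> simp [signalProb]

lemma reportProb_nonneg {θ : ℝ} (h0 : 0 ≤ θ) (h1 : θ ≤ 1) {τ : Bool → Report → ℝ}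
    (hτ : IsStrategy τ) (w : Bool) (y : Report) : 0 ≤ reportProb θ τ w y :=
  Finset.sum_nonneg fun s _ => mul_nonneg (signalProb_nonneg h0 h1 w s) (hτ.1 s y)

lemma sum_reportProb (θ : ℝ) {τ : Bool → Report → ℝ} (hτ : IsStrategy τ) (w : Bool) :
    ∑ y : Report, reportProb θ τ w y = 1 := by
  unfold reportProb
  rw [Finset.sum_comm]
  simp only [← Finset.mul_sum, hτ.2, mul_one, sum_signalProb]

lemma condPay_nonneg {N : ℕ} {θ : ℝ} (h0 : 0 ≤ θ) (h1 : θ ≤ 1)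
    {σ : Fin N → Bool → Report → ℝ} (hσ : ∀ i, IsStrategy (σ i))
    {R : (Fin N → Report) → Fin N → ℝ} (hR : ∀ x i, 0 ≤ R x i)
    (i : Fin N) (y : Report) (w : Bool) : 0 ≤ condPay θ σ R i y w := by
  refine Finset.sum_nonneg fun x _ => ?_
  split_ifs
  · exact mul_nonneg
      (Finset.prod_nonneg fun j _ => reportProb_nonneg h0 h1 (hσ j) w (x j)) (hR x i)
  · exact le_rfl

/-- The payment to `i` conditional on her report does not depend on her own strategy. -/
lemma condPay_update {N : ℕ} (θ : ℝ) (σ : Fin N → Bool → Report → ℝ)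
    (R : (Fin N → Report) → Fin N → ℝ) (i : Fin N) (σ' : Bool → Report → ℝ) :
    condPay θ (Function.update σ i σ') R i = condPay θ σ R i := by
  funext y w
  refine Finset.sum_congr rfl fun x _ => ?_
  rw [Finset.prod_congr rfl fun j hj => by
    rw [Function.update_of_ne (Finset.ne_of_mem_erase hj)]]

/-- Given the state, the reports are independent. -/
lemma sum_jointProb {N : ℕ} (p θ : ℝ) (σ : Fin N → Bool → Report → ℝ)
    (w : Bool) (x : Fin N → Report) :
    ∑ s : Fin N → Bool, jointProb p θ σ w s x =
      (if w then p else 1 - p) * ∏ j, reportProb θ (σ j) w (x j) := by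
  simp only [jointProb, ← Finset.mul_sum, reportProb, Finset.prod_univ_sum,
    Fintype.piFinset_univ]

lemma sum_sum_jointProb_mul {N : ℕ} (p θ : ℝ) (σ : Fin N → Bool → Report → ℝ)
    (w : Bool) (f : (Fin N → Report) → ℝ) :
    ∑ s : Fin N → Bool, ∑ x : Fin N → Report, jointProb p θ σ w s x * f x =
      (if w then p else 1 - p) *
        ∑ x : Fin N → Report, (∏ j, reportProb θ (σ j) w (x j)) * f x := by
  rw [Finset.sum_comm, Finset.mul_sum]
  refine Finset.sum_congr rfl fun x _ => ?_
  rw [← Finset.sum_mul, sum_jointProb, mul_assoc]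

/-- The expectation of a function of one coordinate under a product distribution. -/
lemma sum_prod_mul_apply {ι α : Type*} [Fintype ι] [DecidableEq ι] [Fintype α]
    (m : ι → α → ℝ) (i : ι) (hm : ∀ j, j ≠ i → ∑ y, m j y = 1) (h : α → ℝ) :
    ∑ x : ι → α, (∏ j, m j (x j)) * h (x i) = ∑ y, m i y * h y := by
  have key := Finset.prod_univ_sum (fun _ : ι => (Finset.univ : Finset α))
    (fun j y => m j y * if j = i then h y else 1)
  rw [Fintype.piFinset_univ, Finset.prod_eq_single i
    (fun j _ hj => by simpa [hj] using hm j hj) (by simp)] at key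
  simp only [Finset.prod_mul_distrib, Finset.prod_ite_eq', Finset.mem_univ, if_true] at key
  exact key.symm

/-- Paying the conditional expectation of the payment leaves the expected payment unchanged. -/
lemma expPayGenie_condPay {N : ℕ} (p θ : ℝ) {σ : Fin N → Bool → Report → ℝ}
    (hσ : ∀ i, IsStrategy (σ i)) (R : (Fin N → Report) → Fin N → ℝ) (i : Fin N)
    (Rh : Fin N → Report → Bool → ℝ) (hRh : Rh i = condPay θ σ R i) :
    expPayGenie p θ σ Rh i = expPay p θ σ R i := by
  unfold expPayGenie expPay
  refine Finset.sum_congr rfl fun w _ => ?_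
  rw [sum_sum_jointProb_mul p θ σ w fun x => Rh i (x i) w,
    sum_sum_jointProb_mul p θ σ w fun x => R x i,
    sum_prod_mul_apply (fun j => reportProb θ (σ j) w) i
      (fun j _ => sum_reportProb θ (hσ j) w) fun y => Rh i y w, hRh]
  congr 1
  simp only [condPay, Finset.mul_sum]
  rw [Finset.sum_comm]
  refine Finset.sum_congr rfl fun x _ => ?_
  rw [← Finset.mul_prod_erase Finset.univ _ (Finset.mem_univ i)]
  simp [mul_assoc]

/-- **Lemma 3 (genie-aided replication).**
Any Nash equilibrium of any nonnegative payment mechanism can be replicated, with the same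
expected payments, by a nonnegative genie-aided payment mechanism. -/
theorem genie_aided_replication
    (N : ℕ) (hN : 1 ≤ N) (p θ : ℝ) (hp0 : 0 < p) (hp1 : p < 1)
    (hθ : 1/2 < θ) (hθ1 : θ < 1)
    (g g' : ℝ → ℝ) (hg : ProperCost g g')
    (R : (Fin N → Report) → Fin N → ℝ) (hR : ∀ x i, 0 ≤ R x i)
    (σ : Fin N → Bool → Report → ℝ)
    (hNE : NashEq p θ g σ R) :
    ∃ Rh : Fin N → Report → Bool → ℝ,
      (∀ i x w, 0 ≤ Rh i x w) ∧
      NashEqGenie p θ g σ Rh ∧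
      ∀ i : Fin N, expPayGenie p θ σ Rh i = expPay p θ σ R i := by
  have hσ := hNE.1
  have hpay : ∀ (i : Fin N) (σ' : Bool → Report → ℝ), IsStrategy σ' →
      expPayGenie p θ (Function.update σ i σ') (condPay θ σ R) i =
        expPay p θ (Function.update σ i σ') R i := fun i σ' hσ' =>
    expPayGenie_condPay p θ ((Function.forall_update_iff σ fun _ τ => IsStrategy τ).2
      ⟨hσ', fun j _ => hσ j⟩) R i _ (condPay_update θ σ R i σ').symm
  have hpay_eq : ∀ i, expPayGenie p θ σ (condPay θ σ R) i = expPay p θ σ R i := fun i =>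
    expPayGenie_condPay p θ hσ R i _ rfl
  refine ⟨condPay θ σ R, condPay_nonneg (by linarith) hθ1.le hσ hR,
    ⟨hσ, fun i σ' hσ' => ?_⟩, hpay_eq⟩
  rw [utilityGenie, utilityGenie, hpay i σ' hσ', hpay_eq i]
  exact hNE.2 i σ' hσ'
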